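/- General characterization of the Knothe–Rosenblatt rearrangement: For arbitrary Borel probability measures μ, ν on ℝ^N, the Knothe–Rosenblatt rearrangement of (μ,ν) is the unique bicausal transport plan γ ∈ Π_bc(μ,ν) which is an increasing triangular transport, i.e. such that γ(dx₁,dy₁) and, for each t ≥ 2 and γ-almost every (x₁,…,x_{t−1},y₁,…,y_{t−1}), the kernel γ^{x₁,…,x_{t−1},y₁,…,y_{t−1}}(dx_t,dy_t) all have monotone support as bivariate measures (a set Γ ⊆ ℝ² is monotone if (x,y),(x̄,ȳ) ∈ Γ and x < x̄ imply y ≤ ȳ). -/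

import Mathlib

open MeasureTheory ProbabilityTheory Set Filter
open scoped ENNReal NNReal BoundedContinuousFunction

noncomputable section

namespace CausalTransport

/-- The path space of a real-valued process in `N` time steps. -/
abbrev Path (N : ℕ) := Fin N → ℝ

/-- Truncation of a path to its first `t` coordinates. -/
def proj (N t : ℕ) (x : Path N) : Fin t → ℝ :=
  fun i => if h : (i : ℕ) < N then x ⟨i, h⟩ else 0

/-- The coordinate with (0-based) index `t`, with junk value `0` if `t ≥ N`. -/
def coord (N t : ℕ) (x : Path N) : ℝ := if h : t < N then x ⟨t, h⟩ else 0

/-- The coordinates of a path after time `t`. -/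
def tailProj (N t : ℕ) (x : Path N) : Fin (N - t) → ℝ := fun i => coord N (t + i) x

/-- Extension of a history of length `t` by one further value. -/
def snocFun (t : ℕ) (xs : Fin t → ℝ) (r : ℝ) : Fin (t + 1) → ℝ :=
  fun i => if h : (i : ℕ) < t then xs ⟨i, h⟩ else r

/-- Extension of a history of length `t` to a full path (by `0`). -/
def pad (N t : ℕ) (xs : Fin t → ℝ) : Path N :=
  fun i => if h : (i : ℕ) < t then xs ⟨i, h⟩ else 0

/-- Glue the first `t` coordinates of `x` with the later coordinates `z`. -/
def glue (N t : ℕ) (x : Path N) (z : Fin (N - t) → ℝ) : Path N :=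
  fun i => if (i : ℕ) < t then x i else
    if h : (i : ℕ) - t < N - t then z ⟨(i : ℕ) - t, h⟩ else 0

/-- Truncation of a pair of paths to the first `t` coordinates of each. -/
def pairProj (N t : ℕ) (p : Path N × Path N) : (Fin t → ℝ) × (Fin t → ℝ) :=
  (proj N t p.1, proj N t p.2)

/-- The σ-algebra on path space generated by the first `t` coordinates. -/
def filt (N t : ℕ) : MeasurableSpace (Path N) :=
  MeasurableSpace.comap (proj N t) inferInstance

/-- `γ` is a transport plan (coupling) between `μ` and `ν`. -/
def IsCoupling {α β : Type*} [MeasurableSpace α] [MeasurableSpace β]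
    (μ : Measure α) (ν : Measure β) (γ : Measure (α × β)) : Prop :=
  γ.map Prod.fst = μ ∧ γ.map Prod.snd = ν

/-- `γ` is a causal transport plan between `μ` and `ν`: it is a coupling and, for any
disintegration `K` of `γ` over its first coordinate and any `t ∈ {1,…,N}`, the map
`x ↦ K x B` is measurable for the σ-algebra of the first `t` coordinates (up to `μ`-null
sets) whenever `B` is measurable for the first `t` coordinates. -/
def IsCausal (N : ℕ) (μ ν : Measure (Path N)) (γ : Measure (Path N × Path N)) : Prop :=
  IsCoupling μ ν γ ∧
  ∀ K : Kernel (Path N) (Path N), IsSFiniteKernel K → μ ⊗ₘ K = γ →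
    ∀ t : ℕ, 1 ≤ t → t ≤ N → ∀ B : Set (Path N), MeasurableSet[filt N t] B →
      ∃ g : Path N → ℝ≥0∞, Measurable[filt N t] g ∧ (fun x => K x B) =ᵐ[μ] g

/-- `γ` is a bicausal transport plan between `μ` and `ν`. -/
def IsBicausal (N : ℕ) (μ ν : Measure (Path N)) (γ : Measure (Path N × Path N)) : Prop :=
  IsCausal N μ ν γ ∧ IsCausal N ν μ (γ.map Prod.swap)

/-- Regular conditional distribution, under `μ`, of the coordinate of index `t`
given the first `t` coordinates. -/
def nextK (N : ℕ) (μ : Measure (Path N)) [IsFiniteMeasure μ] (t : ℕ) :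
    Kernel (Fin t → ℝ) ℝ :=
  (μ.map (fun x => (proj N t x, coord N t x))).condKernel

/-- Regular conditional distribution, under `μ`, of all the coordinates after time `t`
given the first `t` coordinates. -/
def tailK (N : ℕ) (μ : Measure (Path N)) [IsFiniteMeasure μ] (t : ℕ) :
    Kernel (Fin t → ℝ) (Fin (N - t) → ℝ) :=
  (μ.map (fun x => (proj N t x, tailProj N t x))).condKernel

/-- Regular conditional distribution, under `γ`, of the pair of coordinates of index `t`
given the first `t` coordinates of both paths. -/
def stepK (N : ℕ) (γ : Measure (Path N × Path N)) [IsFiniteMeasure γ] (t : ℕ) :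
    Kernel ((Fin t → ℝ) × (Fin t → ℝ)) (ℝ × ℝ) :=
  (γ.map (fun p => (pairProj N t p, (coord N t p.1, coord N t p.2)))).condKernel

/-- Regular conditional distribution, under `μ`, of the coordinate of index `t` given the
single coordinate of index `t-1` (one-step Markov transition kernel). -/
def mstep (N : ℕ) (μ : Measure (Path N)) [IsFiniteMeasure μ] (t : ℕ) : Kernel ℝ ℝ :=
  (μ.map (fun x => (coord N (t - 1) x, coord N t x))).condKernel

/-- `μ` is a Markov measure. -/
def IsMarkovMeasure (N : ℕ) (μ : Measure (Path N)) [IsFiniteMeasure μ] : Prop :=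
  ∀ (t : ℕ) (ht : 1 ≤ t) (_ : t < N),
    ∀ᵐ xs ∂(μ.map (proj N t)), nextK N μ t xs = mstep N μ t (xs ⟨t - 1, by omega⟩)

/-- A causal plan is causal quasi-Markov if (every version of) the conditional law of
`(x_{t+1}, y_{t+1})` given `(x_1,…,x_t,y_1,…,y_t)` depends a.s. only on `(x_t, y_1,…,y_t)`. -/
def IsQuasiMarkov (N : ℕ) (γ : Measure (Path N × Path N)) : Prop :=
  ∀ (t : ℕ) (ht : 1 ≤ t) (_ : t < N),
    ∀ S : Kernel ((Fin t → ℝ) × (Fin t → ℝ)) (ℝ × ℝ), IsSFiniteKernel S →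
      (γ.map (pairProj N t)) ⊗ₘ S
          = γ.map (fun p => (pairProj N t p, (coord N t p.1, coord N t p.2))) →
      ∃ κ : Kernel (ℝ × (Fin t → ℝ)) (ℝ × ℝ),
        ∀ᵐ z ∂(γ.map (pairProj N t)), S z = κ (z.1 ⟨t - 1, by omega⟩, z.2)

/-- Topological support of a measure. -/
def msupport {α : Type*} [TopologicalSpace α] [MeasurableSpace α] (μ : Measure α) : Set α :=
  {x | ∀ U : Set α, IsOpen U → x ∈ U → μ U ≠ 0}

/-- `K` is a version of the disintegration of `μ` at time `t` which is weakly continuous on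
the support of the first `t` coordinates of `μ`. -/
def WeaklyContinuousDisintegration (N t : ℕ) (μ : Measure (Path N))
    (K : Kernel (Fin t → ℝ) (Fin (N - t) → ℝ)) : Prop :=
  IsMarkovKernel K ∧
  (μ.map (proj N t)) ⊗ₘ K = μ.map (fun x => (proj N t x, tailProj N t x)) ∧
  ∀ f : (Fin (N - t) → ℝ) →ᵇ ℝ,
    ContinuousOn (fun xs => ∫ z, f z ∂(K xs)) (msupport (μ.map (proj N t)))

/-- `μ` is successively weakly continuous. -/
def SuccWeakCont (N : ℕ) (μ : Measure (Path N)) : Prop :=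
  ∀ t : ℕ, t < N → ∃ K : Kernel (Fin t → ℝ) (Fin (N - t) → ℝ),
    WeaklyContinuousDisintegration N t μ K

/-- The cumulative distribution function of a measure on `ℝ`. -/
def cdf1 (η : Measure ℝ) (z : ℝ) : ℝ := (η (Iic z)).toReal

/-- The left-continuous generalized inverse (quantile function) of the c.d.f. of `η`. -/
def qinv (η : Measure ℝ) (u : ℝ) : ℝ := sInf {y : ℝ | u ≤ cdf1 η y}

/-- Partial Knothe–Rosenblatt path built from the "uniform" inputs `u`. -/
def krPartial (N : ℕ) (μ : Measure (Path N)) [IsFiniteMeasure μ] (u : ℕ → ℝ) :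
    (t : ℕ) → Fin t → ℝ
  | 0 => Fin.elim0
  | t + 1 => snocFun t (krPartial N μ u t)
      (qinv (nextK N μ t (krPartial N μ u t)) (u t))

/-- The Knothe–Rosenblatt (quantile transform) path built from uniform inputs. -/
def krPath (N : ℕ) (μ : Measure (Path N)) [IsFiniteMeasure μ] (u : Path N) : Path N :=
  krPartial N μ (fun n => if h : n < N then u ⟨n, h⟩ else 0) N

/-- The uniform distribution on `[0,1]`. -/
def unif01 : Measure ℝ := volume.restrict (Icc (0 : ℝ) 1)

instance : IsProbabilityMeasure unif01 := by
  constructor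
  simp [unif01, Real.volume_Icc]

/-- N independent uniforms on `[0,1]`. -/
def uniformCube (N : ℕ) : Measure (Path N) := Measure.pi fun _ => unif01

instance (N : ℕ) : IsProbabilityMeasure (uniformCube N) :=
  inferInstanceAs (IsProbabilityMeasure (Measure.pi fun _ : Fin N => unif01))

/-- The (increasing) Knothe–Rosenblatt rearrangement of `(μ, ν)`: the joint law of
`(X*, Y*)` where both paths are built from the same independent uniforms. -/
def krCoupling (N : ℕ) (μ ν : Measure (Path N)) [IsFiniteMeasure μ] [IsFiniteMeasure ν] :
    Measure (Path N × Path N) :=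
  (uniformCube N).map (fun u => (krPath N μ u, krPath N ν u))

/-- Partial Knothe–Rosenblatt Monge map. -/
def krMapPartial (N : ℕ) (μ ν : Measure (Path N)) [IsFiniteMeasure μ] [IsFiniteMeasure ν]
    (x : Path N) : (t : ℕ) → Fin t → ℝ
  | 0 => Fin.elim0
  | t + 1 => snocFun t (krMapPartial N μ ν x t)
      (qinv (nextK N ν t (krMapPartial N μ ν x t))
        (cdf1 (nextK N μ t (proj N t x)) (coord N t x)))

/-- The Knothe–Rosenblatt Monge map from `μ` to `ν`. -/
def krMap (N : ℕ) (μ ν : Measure (Path N)) [IsFiniteMeasure μ] [IsFiniteMeasure ν]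
    (x : Path N) : Path N :=
  krMapPartial N μ ν x N

open Classical in
/-- Relative entropy `Ent(ν|μ)`, via the nonnegative integrand `f log f - f + 1`,
`f = dν/dμ`; equals `∫ log (dν/dμ) dν` for probability measures. -/
def relEnt {α : Type*} [MeasurableSpace α] (ν μ : Measure α) : ℝ≥0∞ :=
  if ν ≪ μ then
    ∫⁻ x, ENNReal.ofReal
      ((ν.rnDeriv μ x).toReal * Real.log (ν.rnDeriv μ x).toReal
        - (ν.rnDeriv μ x).toReal + 1) ∂μ
  else ∞

/-- Universally measurable `ℝ≥0∞`-valued function. -/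
def UnivMeasurable {α : Type*} [MeasurableSpace α] (f : α → ℝ≥0∞) : Prop :=
  ∀ P : Measure α, IsFiniteMeasure P → AEMeasurable f P

/-- A monotone subset of the plane. -/
def MonotoneSet (S : Set (ℝ × ℝ)) : Prop :=
  ∀ p ∈ S, ∀ q ∈ S, p.1 < q.1 → p.2 ≤ q.2

/-- Increasing triangular transport plan: the initial bivariate distribution, and
a.e. every successive bivariate disintegration, have monotone support. -/
def IsIncreasingTriangularPlan (N : ℕ) (γ : Measure (Path N × Path N)) : Prop :=
  MonotoneSet (msupport (γ.map (fun p => (coord N 0 p.1, coord N 0 p.2)))) ∧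
  ∀ (t : ℕ), 1 ≤ t → t < N →
    ∀ S : Kernel ((Fin t → ℝ) × (Fin t → ℝ)) (ℝ × ℝ), IsSFiniteKernel S →
      (γ.map (pairProj N t)) ⊗ₘ S
          = γ.map (fun p => (pairProj N t p, (coord N t p.1, coord N t p.2))) →
      ∀ᵐ z ∂(γ.map (pairProj N t)), MonotoneSet (msupport (S z))


lemma cdf1_eq (η : Measure ℝ) [IsProbabilityMeasure η] (z : ℝ) : cdf1 η z = cdf η z := by
  rw [cdf_eq_real]; rfl

lemma bddBelow_qset (η : Measure ℝ) [IsProbabilityMeasure η] {u : ℝ} (hu : 0 < u) :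
    BddBelow {y : ℝ | u ≤ cdf1 η y} := by
  have h := (tendsto_cdf_atBot η).eventually (gt_mem_nhds hu)
  obtain ⟨a, ha⟩ := h.exists
  refine ⟨a, fun y hy => ?_⟩
  by_contra hlt
  push Not at hlt
  have := monotone_cdf η hlt.le
  simp only [mem_ofPred_eq, cdf1_eq] at hy
  linarith

lemma qinv_le_iff (η : Measure ℝ) [IsProbabilityMeasure η] {u : ℝ} (hu : 0 < u)
    (hne : {y : ℝ | u ≤ cdf1 η y}.Nonempty) (y : ℝ) :
    qinv η u ≤ y ↔ u ≤ cdf1 η y := by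
  constructor
  · intro h
    have hz : ∀ z, y < z → u ≤ cdf η z := by
      intro z hz
      obtain ⟨w, hw, hwz⟩ := exists_lt_of_csInf_lt hne (lt_of_le_of_lt h hz)
      simp only [mem_ofPred_eq, cdf1_eq] at hw
      exact hw.trans (monotone_cdf η hwz.le)
    rw [cdf1_eq]
    have hc : Tendsto (cdf η) (nhdsWithin y (Ioi y)) (nhds (cdf η y)) :=
      ((cdf η).right_continuous y).tendsto.mono_left (nhdsWithin_mono _ Ioi_subset_Ici_self)
    exact ge_of_tendsto hc (by filter_upwards [self_mem_nhdsWithin] with z hz' using hz z hz')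
  · intro h
    exact csInf_le (bddBelow_qset η hu) h

lemma qset_nonempty (η : Measure ℝ) [IsProbabilityMeasure η] {u : ℝ} (hu : u < 1) :
    {y : ℝ | u ≤ cdf1 η y}.Nonempty := by
  obtain ⟨a, ha⟩ := ((tendsto_cdf_atTop η).eventually (lt_mem_nhds hu)).exists
  exact ⟨a, by simp only [mem_ofPred_eq, cdf1_eq]; exact ha.le⟩

lemma qinv_mono (η : Measure ℝ) [IsProbabilityMeasure η] {u v : ℝ} (hu : 0 < u) (hv : v < 1)
    (h : u ≤ v) : qinv η u ≤ qinv η v := by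
  rw [qinv_le_iff η hu (qset_nonempty η (h.trans_lt hv))]
  exact h.trans ((qinv_le_iff η (hu.trans_le h) (qset_nonempty η hv) _).1 le_rfl)

lemma measurable_cdf1 {E : Type*} [MeasurableSpace E] (κ : Kernel E ℝ) (y : ℝ) :
    Measurable (fun z => cdf1 (κ z) y) :=
  (κ.measurable_coe measurableSet_Iic).ennreal_toReal

lemma measurable_qinv {E : Type*} [MeasurableSpace E] (κ : Kernel E ℝ) [IsMarkovKernel κ] :
    Measurable (fun p : E × ℝ => qinv (κ p.1) p.2) := by
  refine measurable_of_Iic fun y => ?_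
  have hA : ∀ y : ℝ, MeasurableSet {p : E × ℝ | p.2 ≤ cdf1 (κ p.1) y} := fun y =>
    measurableSet_le measurable_snd ((measurable_cdf1 κ y).comp measurable_fst)
  have hG : MeasurableSet {p : E × ℝ | 0 < p.2 ∧ ∃ n : ℕ, p.2 ≤ cdf1 (κ p.1) n} := by
    refine (measurableSet_lt measurable_const measurable_snd).inter ?_
    have : {p : E × ℝ | ∃ n : ℕ, p.2 ≤ cdf1 (κ p.1) n}
        = ⋃ n : ℕ, {p : E × ℝ | p.2 ≤ cdf1 (κ p.1) n} := by ext; simp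
    change MeasurableSet {p : E × ℝ | ∃ n : ℕ, p.2 ≤ cdf1 (κ p.1) n}
    rw [this]
    exact MeasurableSet.iUnion fun n => hA n
  have key : (fun p : E × ℝ => qinv (κ p.1) p.2) ⁻¹' Iic y
      = ({p : E × ℝ | 0 < p.2 ∧ ∃ n : ℕ, p.2 ≤ cdf1 (κ p.1) n}
          ∩ {p : E × ℝ | p.2 ≤ cdf1 (κ p.1) y})
        ∪ ({p : E × ℝ | 0 < p.2 ∧ ∃ n : ℕ, p.2 ≤ cdf1 (κ p.1) n}ᶜ ∩ {_p | 0 ≤ y}) := by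
    ext p
    by_cases hp : 0 < p.2 ∧ ∃ n : ℕ, p.2 ≤ cdf1 (κ p.1) n
    · obtain ⟨h0, n, hn⟩ := hp
      have := qinv_le_iff (κ p.1) h0 ⟨n, hn⟩ y
      have hp : 0 < p.2 ∧ ∃ n : ℕ, p.2 ≤ cdf1 (κ p.1) n := ⟨h0, n, hn⟩
      simp only [mem_preimage, mem_Iic, this, mem_union, mem_inter_iff, mem_ofPred_eq,
        mem_compl_iff, hp, true_and, not_true, false_and, or_false]
    · have hq : qinv (κ p.1) p.2 = 0 := by
        unfold qinv
        by_cases h0 : 0 < p.2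
        · have : {y : ℝ | p.2 ≤ cdf1 (κ p.1) y} = ∅ := by
            ext w
            simp only [mem_ofPred_eq, mem_empty_iff_false, iff_false]
            intro hw
            obtain ⟨n, hn⟩ := exists_nat_ge w
            refine hp ⟨h0, n, hw.trans ?_⟩
            rw [cdf1_eq, cdf1_eq]
            exact monotone_cdf _ hn
          rw [this, Real.sInf_empty]
        · have : {y : ℝ | p.2 ≤ cdf1 (κ p.1) y} = univ := by
            ext w
            simp only [mem_ofPred_eq, mem_univ, iff_true]
            exact (not_lt.1 h0).trans ENNReal.toReal_nonneg
          rw [this, Real.sInf_univ]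
      simp only [mem_preimage, mem_Iic, hq, mem_union, mem_inter_iff, mem_ofPred_eq,
        mem_compl_iff, hp, false_and, not_false_iff, true_and, false_or]
  rw [key]
  exact (hG.inter (hA y)).union (hG.compl.inter (MeasurableSet.const _))

lemma measurable_qinv_right (η : Measure ℝ) [IsProbabilityMeasure η] : Measurable (qinv η) :=
  (measurable_qinv (Kernel.const Unit η)).comp (measurable_prodMk_left (x := ()))

lemma ae_unif01 : ∀ᵐ u ∂unif01, u ∈ Ioo (0 : ℝ) 1 := by
  unfold unif01
  rw [← restrict_Ioo_eq_restrict_Icc]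
  exact ae_restrict_mem measurableSet_Ioo

lemma unif01_Iic {c : ℝ} (h1 : c ≤ 1) : unif01 (Iic c) = ENNReal.ofReal c := by
  unfold unif01
  rw [Measure.restrict_apply measurableSet_Iic]
  have : Iic c ∩ Icc 0 1 = Icc 0 c := by
    ext x; simp only [mem_inter_iff, mem_Iic, mem_Icc]; constructor
    · tauto
    · intro h; exact ⟨h.2, h.1, h.2.trans h1⟩
  rw [this, Real.volume_Icc, sub_zero]

lemma map_qinv (η : Measure ℝ) [IsProbabilityMeasure η] : unif01.map (qinv η) = η := by
  have := Measure.isProbabilityMeasure_map (μ := unif01) (measurable_qinv_right η).aemeasurable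
  refine Measure.ext_of_Iic _ _ fun a => ?_
  rw [Measure.map_apply (measurable_qinv_right η) measurableSet_Iic]
  have : (qinv η ⁻¹' Iic a : Set ℝ) =ᵐ[unif01] Iic (cdf1 η a) := by
    filter_upwards [ae_unif01] with u hu
    exact propext (qinv_le_iff η hu.1 (qset_nonempty η hu.2) a)
  rw [measure_congr this, unif01_Iic, cdf1_eq, ofReal_cdf]
  rw [cdf1_eq]; exact cdf_le_one _ _

lemma monotone_comon (η η' : Measure ℝ) [IsProbabilityMeasure η] [IsProbabilityMeasure η'] :
    MonotoneSet (msupport (unif01.map (fun u => (qinv η u, qinv η' u)))) := by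
  have hm : Measurable (fun u => (qinv η u, qinv η' u)) :=
    (measurable_qinv_right η).prodMk (measurable_qinv_right η')
  have key : ∀ p ∈ msupport (unif01.map (fun u => (qinv η u, qinv η' u))), ∀ U, IsOpen U → p ∈ U →
      ∃ u ∈ Ioo (0 : ℝ) 1, (qinv η u, qinv η' u) ∈ U := by
    intro p hp U hU hpU
    by_contra hcon
    push Not at hcon
    refine hp U hU hpU ?_
    rw [Measure.map_apply hm hU.measurableSet]
    refine measure_mono_null (t := (Ioo (0 : ℝ) 1)ᶜ) ?_ ae_unif01
    intro u hu hu'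
    exact hcon u hu' hu
  intro p hp q hq hlt
  by_contra hgt
  push Not at hgt
  obtain ⟨a, ha1, ha2⟩ := exists_between hlt
  obtain ⟨b, hb1, hb2⟩ := exists_between hgt
  obtain ⟨u, hu, hu1, hu2⟩ := key p hp (Iio a ×ˢ Ioi b) (isOpen_Iio.prod isOpen_Ioi) ⟨ha1, hb2⟩
  obtain ⟨v, hv, hv1, hv2⟩ := key q hq (Ioi a ×ˢ Iio b) (isOpen_Ioi.prod isOpen_Iio) ⟨ha2, hb1⟩
  simp only [mem_Iio, mem_Ioi] at hu1 hu2 hv1 hv2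
  rcases le_total u v with h | h
  · have := qinv_mono η' hu.1 hv.2 h
    linarith
  · have := qinv_mono η hv.1 hu.2 h
    linarith

lemma msupport_eq {α : Type*} [TopologicalSpace α] [MeasurableSpace α] (μ : Measure α) :
    msupport μ = μ.support := by
  rw [Measure.support_eq_forall_isOpen]
  ext x
  simp only [msupport, mem_ofPred_eq, pos_iff_ne_zero]
  constructor
  · intro h U hx hU; exact h U hU hx
  · intro h U hU hx; exact h U hx hU

lemma rect_of_monotone (γ : Measure (ℝ × ℝ)) (h : MonotoneSet (msupport γ)) (a b : ℝ) :
    γ (Iic a ×ˢ Iic b) = min (γ.map Prod.fst (Iic a)) (γ.map Prod.snd (Iic b)) := by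
  rw [Measure.map_apply measurable_fst measurableSet_Iic,
    Measure.map_apply measurable_snd measurableSet_Iic]
  have hae : ∀ᵐ p ∂γ, p ∈ msupport γ := by
    rw [msupport_eq]; exact Measure.support_mem_ae
  have h1 : γ (Iic a ×ˢ Iic b) ≤ γ (Prod.fst ⁻¹' Iic a) := measure_mono fun p hp => hp.1
  have h2 : γ (Iic a ×ˢ Iic b) ≤ γ (Prod.snd ⁻¹' Iic b) := measure_mono fun p hp => hp.2
  refine le_antisymm (le_min h1 h2) ?_
  by_cases hc : ∃ p ∈ msupport γ, p.1 ≤ a ∧ b < p.2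
  · obtain ⟨p, hp, hpa, hpb⟩ := hc
    refine (min_le_right _ _).trans (measure_mono_ae ?_)
    filter_upwards [hae] with q hq hqb
    refine ⟨?_, hqb⟩
    by_contra hqa
    have hqa' : a < q.1 := not_le.1 hqa
    have hqb' : q.2 ≤ b := hqb
    have := h p hp q hq (hpa.trans_lt hqa')
    linarith
  · push Not at hc
    refine (min_le_left _ _).trans (measure_mono_ae ?_)
    filter_upwards [hae] with q hq hqa
    exact ⟨hqa, hc q hq hqa⟩

lemma eq_of_rect (γ γ' : Measure (ℝ × ℝ)) [IsProbabilityMeasure γ] [IsProbabilityMeasure γ']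
    (h : ∀ a b, γ (Iic a ×ˢ Iic b) = γ' (Iic a ×ˢ Iic b)) : γ = γ' := by
  have hs : IsCountablySpanning (range (Iic : ℝ → Set ℝ)) :=
    ⟨fun n : ℕ => Iic (n : ℝ), fun n => mem_range_self _, by
      ext x; simp only [mem_iUnion, mem_Iic, mem_univ, iff_true]; exact exists_nat_ge x⟩
  have hb : MeasurableSpace.generateFrom (range (Iic : ℝ → Set ℝ)) = borel ℝ :=
    (borel_eq_generateFrom_Iic ℝ).symm
  have hb' : MeasurableSpace.generateFrom (range (Iic : ℝ → Set ℝ)) = Real.measurableSpace := by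
    rw [hb]; exact (BorelSpace.measurable_eq (α := ℝ)).symm
  refine ext_of_generate_finite _ (generateFrom_eq_prod hb' hb' hs hs).symm
    (isPiSystem_Iic.prod isPiSystem_Iic) ?_ (by simp)
  rintro _ ⟨_, ⟨a, rfl⟩, _, ⟨b, rfl⟩, rfl⟩
  exact h a b

lemma comon_unique (η η' : Measure ℝ) [IsProbabilityMeasure η] [IsProbabilityMeasure η']
    (γ : Measure (ℝ × ℝ)) (h : MonotoneSet (msupport γ)) (h1 : γ.map Prod.fst = η)
    (h2 : γ.map Prod.snd = η') : γ = unif01.map (fun u => (qinv η u, qinv η' u)) := by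
  have hm : Measurable (fun u => (qinv η u, qinv η' u)) :=
    (measurable_qinv_right η).prodMk (measurable_qinv_right η')
  have : IsProbabilityMeasure γ := by
    constructor
    have := measure_univ (μ := η)
    rwa [← h1, Measure.map_apply measurable_fst .univ] at this
  have := Measure.isProbabilityMeasure_map (μ := unif01) hm.aemeasurable
  refine eq_of_rect _ _ fun a b => ?_
  rw [rect_of_monotone _ h, rect_of_monotone _ (monotone_comon η η'), h1, h2,
    Measure.map_map measurable_fst hm, Measure.map_map measurable_snd hm]
  change _ = min (unif01.map (qinv η) _) (unif01.map (qinv η') _)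
  rw [map_qinv, map_qinv]


/-- Extension of the inputs by `0`. -/
def uext (N : ℕ) (u : Path N) : ℕ → ℝ := fun n => if h : n < N then u ⟨n, h⟩ else 0

/-- Inputs from `u` before `t`, from `v` afterwards. -/
def mix (N t : ℕ) (u v : Path N) : Path N := fun i => if (i : ℕ) < t then u i else v i

lemma measurable_uext (N n : ℕ) : Measurable (fun u : Path N => uext N u n) := by
  unfold uext
  by_cases h : n < N
  · simp only [h, dite_true]; exact measurable_pi_apply _
  · simp only [h, dite_false]; exact measurable_const

lemma measurable_mix (N t : ℕ) : Measurable (fun p : Path N × Path N => mix N t p.1 p.2) := by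
  refine measurable_pi_lambda _ fun i => ?_
  unfold mix
  by_cases h : (i : ℕ) < t
  · simp only [h, if_true]; fun_prop
  · simp only [h, if_false]; fun_prop

lemma uext_mix_lt (N t n : ℕ) (u v : Path N) (h : n < t) :
    uext N (mix N t u v) n = uext N u n := by
  unfold uext mix
  by_cases hn : n < N <;> simp [hn, h]

lemma uext_mix_ge (N t n : ℕ) (u v : Path N) (h : t ≤ n) :
    uext N (mix N t u v) n = uext N v n := by
  unfold uext mix
  by_cases hn : n < N <;> simp [hn, not_lt.2 h]

lemma map_mix (N t : ℕ) :
    ((uniformCube N).prod (uniformCube N)).map (fun p => mix N t p.1 p.2) = uniformCube N := by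
  symm
  refine Measure.pi_eq fun s hs => ?_
  rw [Measure.map_apply (measurable_mix N t) (MeasurableSet.univ_pi hs)]
  have : (fun p : Path N × Path N => mix N t p.1 p.2) ⁻¹' (univ.pi s)
      = (univ.pi fun i : Fin N => if (i : ℕ) < t then s i else univ)
        ×ˢ (univ.pi fun i : Fin N => if (i : ℕ) < t then univ else s i) := by
    ext p
    simp only [mem_preimage, Set.mem_pi, mem_univ, true_imp_iff, mem_prod, mix]
    rw [← forall_and]
    refine forall_congr' fun i => ?_
    by_cases h : (i : ℕ) < t <;> simp [h]
  rw [this, Measure.prod_prod, uniformCube, Measure.pi_pi, Measure.pi_pi, ← Finset.prod_mul_distrib]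
  refine Finset.prod_congr rfl fun i _ => ?_
  by_cases h : (i : ℕ) < t <;> simp [h]

lemma measurable_proj (N t : ℕ) : Measurable (proj N t) := by
  refine measurable_pi_lambda _ fun i => ?_
  exact measurable_uext N i

lemma measurable_coord (N t : ℕ) : Measurable (coord N t) := measurable_uext N t

lemma measurable_snocFun (t : ℕ) :
    Measurable (fun p : (Fin t → ℝ) × ℝ => snocFun t p.1 p.2) := by
  refine measurable_pi_lambda _ fun i => ?_
  unfold snocFun
  by_cases h : (i : ℕ) < t
  · simp only [h, dite_true]; fun_prop
  · simp only [h, dite_false]; fun_prop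

lemma proj_succ (N t : ℕ) (x : Path N) :
    proj N (t + 1) x = snocFun t (proj N t x) (coord N t x) := by
  funext i
  unfold proj snocFun coord
  by_cases h : (i : ℕ) < t
  · simp [h]
  · have : (i : ℕ) = t := by omega
    simp [this]

lemma proj_self (N : ℕ) (x : Path N) : proj N N x = x := by
  funext i
  simp [proj]

instance instMarkovNextK (N : ℕ) (μ : Measure (Path N)) [IsFiniteMeasure μ] (t : ℕ) :
    IsMarkovKernel (nextK N μ t) := by
  unfold nextK; infer_instance

lemma nextK_disint (N : ℕ) (μ : Measure (Path N)) [IsFiniteMeasure μ] (t : ℕ) :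
    (μ.map (proj N t)) ⊗ₘ nextK N μ t = μ.map (fun x => (proj N t x, coord N t x)) := by
  have h := (μ.map (fun x => (proj N t x, coord N t x))).disintegrate
    (μ.map (fun x => (proj N t x, coord N t x))).condKernel
  rwa [Measure.fst_map_prodMk (measurable_coord N t)] at h

lemma krPartial_congr (N : ℕ) (μ : Measure (Path N)) [IsFiniteMeasure μ] (u v : ℕ → ℝ) (t : ℕ)
    (h : ∀ n < t, u n = v n) : krPartial N μ u t = krPartial N μ v t := by
  induction t with
  | zero => rfl
  | succ t ih =>
    simp only [krPartial]
    rw [ih fun n hn => h n (by omega), h t (by omega)]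

lemma krPartial_mix (N : ℕ) (μ : Measure (Path N)) [IsFiniteMeasure μ] (t : ℕ) (u v : Path N) :
    krPartial N μ (uext N (mix N t u v)) t = krPartial N μ (uext N u) t :=
  krPartial_congr N μ _ _ t fun n hn => uext_mix_lt N t n u v hn

lemma measurable_krPartial (N : ℕ) (μ : Measure (Path N)) [IsFiniteMeasure μ] (t : ℕ) :
    Measurable (fun u : Path N => krPartial N μ (uext N u) t) := by
  induction t with
  | zero => exact measurable_const
  | succ t ih =>
    simp only [krPartial]
    exact (measurable_snocFun t).comp
      (ih.prodMk ((measurable_qinv (nextK N μ t)).comp (ih.prodMk (measurable_uext N t))))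

lemma krPath_eq (N : ℕ) (μ : Measure (Path N)) [IsFiniteMeasure μ] (u : Path N) :
    krPath N μ u = krPartial N μ (uext N u) N := rfl

lemma measurable_krPath (N : ℕ) (μ : Measure (Path N)) [IsFiniteMeasure μ] :
    Measurable (krPath N μ) := measurable_krPartial N μ N

lemma krPartial_apply (N : ℕ) (μ : Measure (Path N)) [IsFiniteMeasure μ] (u : ℕ → ℝ) (i t : ℕ)
    (h : i < t) : krPartial N μ u t ⟨i, h⟩ = krPartial N μ u (i + 1) ⟨i, by omega⟩ := by
  induction t with
  | zero => omega
  | succ t ih =>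
    by_cases hi : i = t
    · subst hi; rfl
    · have hi' : i < t := by omega
      rw [← ih hi']
      simp [krPartial, snocFun, hi']

lemma proj_krPath (N : ℕ) (μ : Measure (Path N)) [IsFiniteMeasure μ] (u : Path N) (t : ℕ)
    (ht : t ≤ N) : proj N t (krPath N μ u) = krPartial N μ (uext N u) t := by
  funext i
  have hi : (i : ℕ) < N := by omega
  simp only [proj, hi, dite_true, krPath_eq]
  rw [krPartial_apply N μ (uext N u) i N hi, ← krPartial_apply N μ (uext N u) i t i.2]

lemma coord_krPath (N : ℕ) (μ : Measure (Path N)) [IsFiniteMeasure μ] (u : Path N) (t : ℕ)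
    (ht : t < N) : coord N t (krPath N μ u)
      = qinv (nextK N μ t (krPartial N μ (uext N u) t)) (uext N u t) := by
  simp only [coord, ht, dite_true, krPath_eq]
  rw [krPartial_apply N μ (uext N u) t N ht]
  simp [krPartial, snocFun]

/-- Push forward of the uniform law under a parametrised map. -/
def pushK {E F : Type*} [MeasurableSpace E] [MeasurableSpace F] (h : E × ℝ → F) : Kernel E F :=
  Kernel.map (Kernel.id ×ₖ Kernel.const E unif01) h

lemma pushK_apply {E F : Type*} [MeasurableSpace E] [MeasurableSpace F] (h : E × ℝ → F)
    (hh : Measurable h) (z : E) : pushK h z = unif01.map (fun u => h (z, u)) := by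
  rw [pushK, Kernel.map_apply _ hh, Kernel.prod_apply, Kernel.id_apply, Kernel.const_apply,
    Measure.dirac_prod, Measure.map_map hh measurable_prodMk_left]
  rfl

lemma pushK_markov {E F : Type*} [MeasurableSpace E] [MeasurableSpace F] (h : E × ℝ → F)
    (hh : Measurable h) : IsMarkovKernel (pushK h) := Kernel.IsMarkovKernel.map _ hh

lemma map_uext (N t : ℕ) (ht : t < N) :
    (uniformCube N).map (fun u => uext N u t) = unif01 := by
  have : (fun u : Path N => uext N u t) = Function.eval ⟨t, ht⟩ := by
    funext u; simp [uext, ht]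
  rw [this]
  exact (measurePreserving_eval (fun _ : Fin N => unif01) ⟨t, ht⟩).map_eq

lemma step_law {E F : Type*} [MeasurableSpace E] [MeasurableSpace F] (N t : ℕ) (ht : t < N)
    (f : Path N → E) (hf : Measurable f) (hfa : ∀ u v, f (mix N t u v) = f u)
    (h : E × ℝ → F) (hh : Measurable h) :
    (uniformCube N).map (fun u => (f u, h (f u, uext N u t)))
      = ((uniformCube N).map f) ⊗ₘ pushK h := by
  have := pushK_markov h hh
  have hm1 : Measurable (fun u => (f u, h (f u, uext N u t))) :=
    hf.prodMk (hh.comp (hf.prodMk (measurable_uext N t)))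
  have hm2 : Measurable (fun q : E × ℝ => (q.1, h q)) := measurable_fst.prodMk hh
  ext s hs
  rw [Measure.map_apply hm1 hs, Measure.compProd_apply hs,
    lintegral_map (Kernel.measurable_kernel_prodMk_left hs) hf]
  conv_lhs => rw [← map_mix N t]
  rw [Measure.map_apply (measurable_mix N t) (hm1 hs),
    Measure.prod_apply (measurable_mix N t (hm1 hs))]
  refine lintegral_congr fun u => ?_
  have hh1 : Measurable (fun r => h (f u, r)) := hh.comp measurable_prodMk_left
  rw [pushK_apply h hh, Measure.map_apply hh1 (measurable_prodMk_left hs)]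
  conv_rhs => rw [← map_uext N t ht]
  rw [Measure.map_apply (measurable_uext N t)]
  · congr 1
    ext v
    simp only [mem_preimage, hfa, uext_mix_ge N t t u v le_rfl]
  · exact hh1 (measurable_prodMk_left hs)

lemma pushK_qinv {E : Type*} [MeasurableSpace E] (κ : Kernel E ℝ) [IsMarkovKernel κ] :
    pushK (fun p : E × ℝ => qinv (κ p.1) p.2) = κ := by
  ext1 z
  rw [pushK_apply _ (measurable_qinv κ)]
  exact map_qinv (κ z)

lemma law_krPartial (N : ℕ) (μ : Measure (Path N)) [IsProbabilityMeasure μ] (t : ℕ) (ht : t ≤ N) :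
    (uniformCube N).map (fun u => krPartial N μ (uext N u) t) = μ.map (proj N t) := by
  induction t with
  | zero =>
    have h1 := Measure.isProbabilityMeasure_map (μ := uniformCube N)
      (measurable_krPartial N μ 0).aemeasurable
    have h2 := Measure.isProbabilityMeasure_map (μ := μ) (measurable_proj N 0).aemeasurable
    ext s hs
    rcases Subsingleton.eq_empty_or_singleton (s := s) subsingleton_of_subsingleton with h | ⟨x, h⟩
    · simp [h]
    · have : s = univ := by rw [h]; ext y; simp [Subsingleton.elim y x]
      rw [this, measure_univ, measure_univ]
  | succ t ih =>
    have ih := ih (by omega)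
    have hs := step_law N t (by omega) _ (measurable_krPartial N μ t) (krPartial_mix N μ t)
      (fun p : (Fin t → ℝ) × ℝ => qinv (nextK N μ t p.1) p.2) (measurable_qinv _)
    rw [pushK_qinv, ih, nextK_disint] at hs
    have h2 := congrArg (Measure.map (fun p : (Fin t → ℝ) × ℝ => snocFun t p.1 p.2)) hs
    rw [Measure.map_map (measurable_snocFun t), Measure.map_map (measurable_snocFun t)] at h2
    · have e1 : proj N (t + 1) = (fun p : (Fin t → ℝ) × ℝ => snocFun t p.1 p.2) ∘
          fun x => (proj N t x, coord N t x) := by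
        funext x; exact proj_succ N t x
      rw [e1, ← h2]
      rfl
    · exact (measurable_proj N t).prodMk (measurable_coord N t)
    · exact (measurable_krPartial N μ t).prodMk ((measurable_qinv (nextK N μ t)).comp
        ((measurable_krPartial N μ t).prodMk (measurable_uext N t)))

lemma law_krPath (N : ℕ) (μ : Measure (Path N)) [IsProbabilityMeasure μ] :
    (uniformCube N).map (krPath N μ) = μ := by
  have h := law_krPartial N μ N le_rfl
  have e : proj N N = id := by funext x; exact proj_self N x
  rw [e, Measure.map_id] at h
  exact h

lemma krPath_cont (N : ℕ) (μ : Measure (Path N)) [IsFiniteMeasure μ] (t : ℕ) (ht : t ≤ N) :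
    ∃ G : (Fin t → ℝ) × Path N → Path N, Measurable G ∧
      ∀ u v, krPath N μ (mix N t u v) = G (krPartial N μ (uext N u) t, v) := by
  have key : ∀ k, ∃ G : (Fin t → ℝ) × Path N → (Fin (t + k) → ℝ), Measurable G ∧
      ∀ u v, krPartial N μ (uext N (mix N t u v)) (t + k)
        = G (krPartial N μ (uext N u) t, v) := by
    intro k
    induction k with
    | zero => exact ⟨Prod.fst, measurable_fst, fun u v => krPartial_mix N μ t u v⟩
    | succ k ih =>
      obtain ⟨G, hG, hGe⟩ := ih
      refine ⟨fun p => snocFun (t + k) (G p) (qinv (nextK N μ (t + k) (G p)) (uext N p.2 (t + k))),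
        ?_, ?_⟩
      · exact (measurable_snocFun (t + k)).comp (hG.prodMk
          ((measurable_qinv (nextK N μ (t + k))).comp
            (hG.prodMk ((measurable_uext N (t + k)).comp measurable_snd))))
      · intro u v
        change snocFun (t + k) (krPartial N μ (uext N (mix N t u v)) (t + k))
          (qinv (nextK N μ (t + k) (krPartial N μ (uext N (mix N t u v)) (t + k)))
            (uext N (mix N t u v) (t + k))) = _
        rw [hGe, uext_mix_ge N t (t + k) u v (by omega)]
  obtain ⟨k, hk⟩ := Nat.exists_eq_add_of_le ht
  have := key k
  rw [← hk] at this
  exact this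

lemma measurable_krPair (N : ℕ) (μ ν : Measure (Path N)) [IsFiniteMeasure μ]
    [IsFiniteMeasure ν] : Measurable (fun u => (krPath N μ u, krPath N ν u)) :=
  (measurable_krPath N μ).prodMk (measurable_krPath N ν)

lemma lintegral_mix (N t : ℕ) (F : Path N → ℝ≥0∞) (hF : Measurable F) :
    ∫⁻ u, F u ∂(uniformCube N)
      = ∫⁻ v, ∫⁻ u, F (mix N t u v) ∂(uniformCube N) ∂(uniformCube N) := by
  conv_lhs => rw [← map_mix N t]
  rw [lintegral_map hF (measurable_mix N t)]
  exact lintegral_prod_symm' _ (hF.comp (measurable_mix N t))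

lemma kr_causal (N : ℕ) (μ ν : Measure (Path N)) [IsProbabilityMeasure μ]
    [IsProbabilityMeasure ν] : IsCausal N μ ν (krCoupling N μ ν) := by
  have hP := measurable_krPair N μ ν
  refine ⟨⟨?_, ?_⟩, ?_⟩
  · rw [krCoupling, Measure.map_map measurable_fst hP]
    exact law_krPath N μ
  · rw [krCoupling, Measure.map_map measurable_snd hP]
    exact law_krPath N ν
  intro K hK hKe t _ ht B hB
  obtain ⟨B', hB', rfl⟩ := hB
  obtain ⟨G, hG, hGe⟩ := krPath_cont N μ t ht
  have hx := measurable_krPartial N μ t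
  have hy := measurable_krPartial N ν t
  set ρ := (uniformCube N).map
    (fun u => (krPartial N μ (uext N u) t, krPartial N ν (uext N u) t)) with hρ
  obtain ⟨R, hRm, hρd⟩ : ∃ R : Kernel (Fin t → ℝ) (Fin t → ℝ), IsMarkovKernel R ∧
      ((uniformCube N).map (fun u => krPartial N μ (uext N u) t)) ⊗ₘ R = ρ := by
    refine ⟨ρ.condKernel, inferInstance, ?_⟩
    have := ρ.disintegrate ρ.condKernel
    have h2 : ρ.fst = (uniformCube N).map (fun u => krPartial N μ (uext N u) t) := by
      rw [hρ, Measure.fst_map_prodMk hy]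
    rwa [h2] at this
  have hg : Measurable fun a => R a B' := Kernel.measurable_coe _ hB'
  refine ⟨fun x => R (proj N t x) B', hg.comp (comap_measurable _), ?_⟩
  have hBm : MeasurableSet (proj N t ⁻¹' B') := measurable_proj N t hB'
  refine ae_eq_of_forall_setLIntegral_eq_of_sigmaFinite (Kernel.measurable_coe _ hBm)
    (hg.comp (measurable_proj N t)) fun A hA _ => ?_
  rw [← Measure.compProd_apply_prod hA hBm, hKe, krCoupling, Measure.map_apply hP (hA.prod hBm)]
  -- right-hand side
  have hR : ∫⁻ x in A, R (proj N t x) B' ∂μ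
      = ∫⁻ u, A.indicator (fun x => R (proj N t x) B') (krPath N μ u)
          ∂(uniformCube N) := by
    rw [← lintegral_indicator hA]
    conv_lhs => rw [← law_krPath N μ]
    exact lintegral_map ((hg.comp (measurable_proj N t)).indicator hA) (measurable_krPath N μ)
  rw [hR]
  have hm3 : Measurable fun u : Path N =>
      A.indicator (fun x => R (proj N t x) B') (krPath N μ u) :=
    ((hg.comp (measurable_proj N t)).indicator hA).comp (measurable_krPath N μ)
  rw [lintegral_mix N t _ hm3]
  conv_lhs => rw [← map_mix N t]
  rw [Measure.map_apply (measurable_mix N t) (hP (hA.prod hBm)),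
    Measure.prod_apply_symm (measurable_mix N t (hP (hA.prod hBm)))]
  refine lintegral_congr fun v => ?_
  have hA' : MeasurableSet {a | G (a, v) ∈ A} := (hG.comp measurable_prodMk_right) hA
  have e1 : (fun u => (u, v)) ⁻¹' ((fun p : Path N × Path N => mix N t p.1 p.2) ⁻¹'
      ((fun u => (krPath N μ u, krPath N ν u)) ⁻¹' A ×ˢ (proj N t ⁻¹' B')))
      = (fun u => (krPartial N μ (uext N u) t, krPartial N ν (uext N u) t)) ⁻¹'
        ({a | G (a, v) ∈ A} ×ˢ B') := by
    ext u
    simp only [mem_preimage, mem_prod, proj_krPath N ν _ t ht, krPartial_mix, hGe]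
    rfl
  rw [e1, ← Measure.map_apply (hx.prodMk hy) (hA'.prod hB'), ← hρ, ← hρd,
    Measure.compProd_apply_prod hA' hB', ← lintegral_indicator hA',
    lintegral_map (hg.indicator hA') hx]
  refine lintegral_congr fun u => ?_
  have : proj N t (G (krPartial N μ (uext N u) t, v)) = krPartial N μ (uext N u) t := by
    rw [← hGe, proj_krPath N μ _ t ht, krPartial_mix]
  rw [hGe]
  by_cases hu : G (krPartial N μ (uext N u) t, v) ∈ A
  · rw [indicator_of_mem hu, indicator_of_mem (show _ ∈ {a | G (a, v) ∈ A} from hu), this]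
  · rw [indicator_of_notMem hu, indicator_of_notMem (show _ ∉ {a | G (a, v) ∈ A} from hu)]

lemma kr_swap (N : ℕ) (μ ν : Measure (Path N)) [IsProbabilityMeasure μ]
    [IsProbabilityMeasure ν] : (krCoupling N μ ν).map Prod.swap = krCoupling N ν μ := by
  rw [krCoupling, Measure.map_map measurable_swap (measurable_krPair N μ ν)]
  rfl

lemma kr_bicausal (N : ℕ) (μ ν : Measure (Path N)) [IsProbabilityMeasure μ]
    [IsProbabilityMeasure ν] : IsBicausal N μ ν (krCoupling N μ ν) :=
  ⟨kr_causal N μ ν, by rw [kr_swap]; exact kr_causal N ν μ⟩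


lemma ae_eq_of_compProd_sfinite {E F : Type*} [MeasurableSpace E] [MeasurableSpace F]
    [MeasurableSpace.CountableOrCountablyGenerated E F]
    (P : Measure E) [IsFiniteMeasure P] (S C : Kernel E F) [IsSFiniteKernel S] [IsMarkovKernel C]
    (h : P ⊗ₘ S = P ⊗ₘ C) : ∀ᵐ z ∂P, S z = C z := by
  classical
  have h1 : (fun z => S z univ) =ᵐ[P] fun z => C z univ := by
    refine ae_eq_of_forall_setLIntegral_eq_of_sigmaFinite (S.measurable_coe .univ)
      (C.measurable_coe .univ) fun A hA _ => ?_
    rw [← Measure.compProd_apply_prod hA .univ, h, Measure.compProd_apply_prod hA .univ]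
  have hs : MeasurableSet {z | S z univ = 1} := S.measurable_coe .univ (measurableSet_singleton 1)
  let S' : Kernel E F := Kernel.piecewise hs S C
  have hS' : S' =ᵐ[P] S := by
    filter_upwards [h1] with z hz
    have : z ∈ {z | S z univ = 1} := by simpa using hz
    simp only [S', Kernel.piecewise_apply]
    rw [if_pos this]
  have : IsFiniteKernel S' := by
    refine ⟨1, ENNReal.one_lt_top, fun z => ?_⟩
    simp only [S', Kernel.piecewise_apply]
    split_ifs with hz
    · exact le_of_eq hz
    · simp
  have h2 : P ⊗ₘ S' = P ⊗ₘ C := by rw [Measure.compProd_congr hS', h]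
  have h3 := Kernel.ae_eq_of_compProd_eq h2
  filter_upwards [hS', h3] with z hz hz'
  rw [← hz, hz']

/-- Joint law of the history and of the next pair of values. -/
def stepMap (N t : ℕ) (p : Path N × Path N) : ((Fin t → ℝ) × (Fin t → ℝ)) × (ℝ × ℝ) :=
  (pairProj N t p, (coord N t p.1, coord N t p.2))

lemma measurable_pairProj (N t : ℕ) : Measurable (pairProj N t) :=
  ((measurable_proj N t).comp measurable_fst).prodMk ((measurable_proj N t).comp measurable_snd)

lemma measurable_coords (N t : ℕ) :
    Measurable (fun p : Path N × Path N => (coord N t p.1, coord N t p.2)) :=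
  ((measurable_coord N t).comp measurable_fst).prodMk ((measurable_coord N t).comp measurable_snd)

lemma measurable_stepMap (N t : ℕ) : Measurable (stepMap N t) :=
  (measurable_pairProj N t).prodMk (measurable_coords N t)

/-- The integrand defining the comonotone kernel. -/
def comonFun (N : ℕ) (μ ν : Measure (Path N)) [IsFiniteMeasure μ] [IsFiniteMeasure ν] (t : ℕ)
    (p : ((Fin t → ℝ) × (Fin t → ℝ)) × ℝ) : ℝ × ℝ :=
  (qinv (nextK N μ t p.1.1) p.2, qinv (nextK N ν t p.1.2) p.2)

lemma measurable_comonFun (N : ℕ) (μ ν : Measure (Path N)) [IsFiniteMeasure μ]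
    [IsFiniteMeasure ν] (t : ℕ) : Measurable (comonFun N μ ν t) :=
  ((measurable_qinv (nextK N μ t)).comp
    ((measurable_fst.comp measurable_fst).prodMk measurable_snd)).prodMk
  ((measurable_qinv (nextK N ν t)).comp
    ((measurable_snd.comp measurable_fst).prodMk measurable_snd))

instance instMarkovComon (N : ℕ) (μ ν : Measure (Path N)) [IsFiniteMeasure μ]
    [IsFiniteMeasure ν] (t : ℕ) : IsMarkovKernel (pushK (comonFun N μ ν t)) :=
  pushK_markov _ (measurable_comonFun N μ ν t)

lemma kr_step (N : ℕ) (μ ν : Measure (Path N)) [IsProbabilityMeasure μ]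
    [IsProbabilityMeasure ν] (t : ℕ) (ht : t < N) :
    (krCoupling N μ ν).map (stepMap N t)
      = ((krCoupling N μ ν).map (pairProj N t)) ⊗ₘ pushK (comonFun N μ ν t) := by
  have h := step_law N t ht
    (fun u => (krPartial N μ (uext N u) t, krPartial N ν (uext N u) t))
    ((measurable_krPartial N μ t).prodMk (measurable_krPartial N ν t))
    (fun u v => by simp only [krPartial_mix]) (comonFun N μ ν t) (measurable_comonFun N μ ν t)
  have hP := measurable_krPair N μ ν
  rw [krCoupling, Measure.map_map (measurable_stepMap N t) hP,
    Measure.map_map (measurable_pairProj N t) hP]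
  have e1 : pairProj N t ∘ (fun u => (krPath N μ u, krPath N ν u))
      = fun u => (krPartial N μ (uext N u) t, krPartial N ν (uext N u) t) := by
    funext u
    simp only [Function.comp, pairProj, proj_krPath N _ u t ht.le]
  have e2 : stepMap N t ∘ (fun u => (krPath N μ u, krPath N ν u))
      = fun u => ((krPartial N μ (uext N u) t, krPartial N ν (uext N u) t),
          comonFun N μ ν t ((krPartial N μ (uext N u) t, krPartial N ν (uext N u) t),
            uext N u t)) := by
    funext u
    simp only [Function.comp, stepMap, pairProj, proj_krPath N _ u t ht.le,
      coord_krPath N _ u t ht, comonFun]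
  rw [e1, e2, h]

lemma comon_apply (N : ℕ) (μ ν : Measure (Path N)) [IsFiniteMeasure μ]
    [IsFiniteMeasure ν] (t : ℕ) (z : (Fin t → ℝ) × (Fin t → ℝ)) :
    pushK (comonFun N μ ν t) z
      = unif01.map (fun u => (qinv (nextK N μ t z.1) u, qinv (nextK N ν t z.2) u)) := by
  rw [pushK_apply _ (measurable_comonFun N μ ν t)]
  simp only [comonFun]

lemma comon_monotone (N : ℕ) (μ ν : Measure (Path N)) [IsFiniteMeasure μ]
    [IsFiniteMeasure ν] (t : ℕ) (z : (Fin t → ℝ) × (Fin t → ℝ)) :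
    MonotoneSet (msupport (pushK (comonFun N μ ν t) z)) := by
  rw [comon_apply]
  exact monotone_comon (nextK N μ t z.1) (nextK N ν t z.2)

lemma kernel_of_subsingleton {E F : Type*} [MeasurableSpace E] [MeasurableSpace F]
    [Subsingleton E] (P : Measure E) [IsProbabilityMeasure P] (S : Kernel E F)
    [IsSFiniteKernel S] (z : E) : (P ⊗ₘ S).map Prod.snd = S z := by
  ext s hs
  rw [Measure.map_apply measurable_snd hs]
  have : (Prod.snd ⁻¹' s : Set (E × F)) = univ ×ˢ s := by ext; simp
  rw [this, Measure.compProd_apply_prod .univ hs, Measure.restrict_univ]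
  have h2 : ∀ a, S a s = S z s := fun a => by rw [Subsingleton.elim a z]
  simp [h2]

lemma step_zero (N : ℕ) (γ : Measure (Path N × Path N)) [IsProbabilityMeasure γ]
    (S : Kernel ((Fin 0 → ℝ) × (Fin 0 → ℝ)) (ℝ × ℝ)) [IsSFiniteKernel S]
    (h : (γ.map (pairProj N 0)) ⊗ₘ S = γ.map (stepMap N 0)) (z) :
    S z = γ.map (fun p => (coord N 0 p.1, coord N 0 p.2)) := by
  have := Measure.isProbabilityMeasure_map (μ := γ) (measurable_pairProj N 0).aemeasurable
  rw [← kernel_of_subsingleton (γ.map (pairProj N 0)) S z, h,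
    Measure.map_map measurable_snd (measurable_stepMap N 0)]
  rfl

instance instProbKr (N : ℕ) (μ ν : Measure (Path N)) [IsProbabilityMeasure μ]
    [IsProbabilityMeasure ν] : IsProbabilityMeasure (krCoupling N μ ν) :=
  Measure.isProbabilityMeasure_map (measurable_krPair N μ ν).aemeasurable

lemma kr_triangular (N : ℕ) (μ ν : Measure (Path N)) [IsProbabilityMeasure μ]
    [IsProbabilityMeasure ν] : IsIncreasingTriangularPlan N (krCoupling N μ ν) := by
  constructor
  · rcases Nat.eq_zero_or_pos N with h0 | hN
    · subst h0
      have key : ∀ p ∈ msupport ((krCoupling 0 μ ν).map (fun p => (coord 0 0 p.1, coord 0 0 p.2))),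
          p = (0, 0) := by
        intro p hp
        by_contra hne
        refine hp {(0, 0)}ᶜ isOpen_compl_singleton hne ?_
        rw [Measure.map_apply (measurable_coords 0 0) (measurableSet_singleton _).compl]
        have : ((fun p : Path 0 × Path 0 => (coord 0 0 p.1, coord 0 0 p.2)) ⁻¹' {(0, 0)}ᶜ) = ∅ := by
          ext p; simp [coord]
        rw [this, measure_empty]
      intro p hp q hq hlt
      rw [key p hp, key q hq] at hlt
      exact absurd hlt (lt_irrefl _)
    · rw [← step_zero N _ (pushK (comonFun N μ ν 0)) (kr_step N μ ν 0 hN).symm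
        (Fin.elim0, Fin.elim0)]
      exact comon_monotone N μ ν 0 _
  · intro t _ ht S hS hSe
    have h := ae_eq_of_compProd_sfinite _ S (pushK (comonFun N μ ν t))
      (hSe.trans (kr_step N μ ν t ht))
    filter_upwards [h] with z hz
    rw [hz]
    exact comon_monotone N μ ν t z

lemma causal_factor (N : ℕ) (μ ν : Measure (Path N)) [IsProbabilityMeasure μ]
    (γ : Measure (Path N × Path N)) (hγ : IsCausal N μ ν γ) (K : Kernel (Path N) (Path N))
    [IsMarkovKernel K] (hK : μ ⊗ₘ K = γ) (t : ℕ) (ht : t ≤ N) (B : Set (Fin t → ℝ))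
    (hB : MeasurableSet B) :
    ∃ g : (Fin t → ℝ) → ℝ≥0∞, Measurable g ∧
      ∀ᵐ x ∂μ, K x (proj N t ⁻¹' B) = g (proj N t x) := by
  rcases Nat.eq_zero_or_pos t with h0 | hpos
  · subst h0
    rcases B.eq_empty_or_nonempty with h | ⟨b, hb⟩
    · exact ⟨fun _ => 0, measurable_const, by simp [h]⟩
    · refine ⟨fun _ => 1, measurable_const, ?_⟩
      have : B = univ := by ext y; simp [Subsingleton.elim y b, hb]
      simp [this]
  · obtain ⟨g, hg, hge⟩ := hγ.2 K inferInstance hK t hpos ht (proj N t ⁻¹' B) ⟨B, hB, rfl⟩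
    obtain ⟨g', hg', rfl⟩ := Measurable.exists_eq_measurable_comp hg
    exact ⟨g', hg', hge⟩

lemma causal_rect (N : ℕ) (μ ν : Measure (Path N)) [IsProbabilityMeasure μ]
    (γ : Measure (Path N × Path N)) [IsProbabilityMeasure γ] (hγ : IsCausal N μ ν γ)
    (t : ℕ) (ht : t ≤ N) (A B : Set (Fin t → ℝ)) (hA : MeasurableSet A) (hB : MeasurableSet B)
    (D : Set ℝ) (hD : MeasurableSet D) :
    γ ((proj N t ⁻¹' A ∩ coord N t ⁻¹' D) ×ˢ (proj N t ⁻¹' B))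
      = ∫⁻ p in (proj N t ⁻¹' A) ×ˢ (proj N t ⁻¹' B), nextK N μ t (proj N t p.1) D ∂γ := by
  have hpj := measurable_proj N t
  have hc := measurable_coord N t
  obtain ⟨K, hKm, hK⟩ : ∃ K : Kernel (Path N) (Path N), IsMarkovKernel K ∧ μ ⊗ₘ K = γ := by
    refine ⟨γ.condKernel, inferInstance, ?_⟩
    have h := γ.disintegrate γ.condKernel
    have h2 : γ.fst = μ := hγ.1.1
    rwa [h2] at h
  obtain ⟨g, hg, hge⟩ := causal_factor N μ ν γ hγ K hK t ht B hB
  have hn : Measurable fun a => nextK N μ t a D := Kernel.measurable_coe _ hD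
  have hL : γ ((proj N t ⁻¹' A ∩ coord N t ⁻¹' D) ×ˢ (proj N t ⁻¹' B))
      = ∫⁻ a in A, g a * nextK N μ t a D ∂(μ.map (proj N t)) := by
    rw [← hK, Measure.compProd_apply_prod ((hpj hA).inter (hc hD)) (hpj hB),
      lintegral_congr_ae (ae_restrict_of_ae hge)]
    have e : proj N t ⁻¹' A ∩ coord N t ⁻¹' D
      = (fun x => (proj N t x, coord N t x)) ⁻¹' (A ×ˢ D) := rfl
    have hg1 : Measurable (fun q : (Fin t → ℝ) × ℝ => g q.1) := hg.comp measurable_fst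
    rw [e, ← setLIntegral_map (f := fun q : (Fin t → ℝ) × ℝ => g q.1) (hA.prod hD)
      hg1 (hpj.prodMk hc), ← nextK_disint, Measure.setLIntegral_compProd hg1 hA hD]
    simp
  have hR : ∫⁻ p in (proj N t ⁻¹' A) ×ˢ (proj N t ⁻¹' B), nextK N μ t (proj N t p.1) D ∂γ
      = ∫⁻ a in A, g a * nextK N μ t a D ∂(μ.map (proj N t)) := by
    have hn1 : Measurable (fun p : Path N × Path N => nextK N μ t (proj N t p.1) D) :=
      hn.comp (hpj.comp measurable_fst)
    have hgn : Measurable (fun a => g a * nextK N μ t a D) := hg.mul hn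
    rw [← hK, Measure.setLIntegral_compProd hn1 (hpj hA) (hpj hB),
      setLIntegral_map hA hgn hpj]
    refine lintegral_congr_ae (ae_restrict_of_ae ?_)
    filter_upwards [hge] with x hx
    simp [hx, mul_comm]
  rw [hL, hR]

lemma causal_fst (N : ℕ) (μ ν : Measure (Path N)) [IsProbabilityMeasure μ]
    (γ : Measure (Path N × Path N)) [IsProbabilityMeasure γ] (hγ : IsCausal N μ ν γ)
    (t : ℕ) (ht : t ≤ N) :
    γ.map (fun p => (pairProj N t p, coord N t p.1))
      = (γ.map (pairProj N t)) ⊗ₘ ((nextK N μ t).comap Prod.fst measurable_fst) := by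
  refine Measure.ext_prod₃' fun {A B D} hA hB hD => ?_
  have hm : Measurable (fun p : Path N × Path N => (pairProj N t p, coord N t p.1)) :=
    (measurable_pairProj N t).prodMk ((measurable_coord N t).comp measurable_fst)
  rw [Measure.map_apply hm ((hA.prod hB).prod hD),
    Measure.compProd_apply_prod (hA.prod hB) hD,
    setLIntegral_map (hA.prod hB) (Kernel.measurable_coe _ hD) (measurable_pairProj N t)]
  refine Eq.trans ?_ (causal_rect N μ ν γ hγ t ht A B hA hB D hD)
  congr 1
  ext p
  simp only [mem_preimage, mem_prod, pairProj, mem_inter_iff]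
  tauto

lemma causal_snd (N : ℕ) (μ ν : Measure (Path N)) [IsProbabilityMeasure ν]
    (γ : Measure (Path N × Path N)) [IsProbabilityMeasure γ]
    (hγ : IsCausal N ν μ (γ.map Prod.swap)) (t : ℕ) (ht : t ≤ N) :
    γ.map (fun p => (pairProj N t p, coord N t p.2))
      = (γ.map (pairProj N t)) ⊗ₘ ((nextK N ν t).comap Prod.snd measurable_snd) := by
  have := Measure.isProbabilityMeasure_map (μ := γ) measurable_swap.aemeasurable
  refine Measure.ext_prod₃' fun {A B D} hA hB hD => ?_
  have hm : Measurable (fun p : Path N × Path N => (pairProj N t p, coord N t p.2)) :=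
    (measurable_pairProj N t).prodMk ((measurable_coord N t).comp measurable_snd)
  rw [Measure.map_apply hm ((hA.prod hB).prod hD),
    Measure.compProd_apply_prod (hA.prod hB) hD,
    setLIntegral_map (hA.prod hB) (Kernel.measurable_coe _ hD) (measurable_pairProj N t)]
  have hpj := measurable_proj N t
  have hc := measurable_coord N t
  have hn1 : Measurable (fun p : Path N × Path N => nextK N ν t (proj N t p.1) D) :=
    (Kernel.measurable_coe (nextK N ν t) hD).comp (hpj.comp measurable_fst)
  have h := causal_rect N ν μ _ hγ t ht B A hB hA D hD
  rw [Measure.map_apply measurable_swap (((hpj hB).inter (hc hD)).prod (hpj hA)),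
    setLIntegral_map ((hpj hB).prod (hpj hA)) hn1 measurable_swap] at h
  refine Eq.trans ?_ (h.trans ?_)
  · congr 1
    ext p
    simp only [mem_preimage, mem_prod, pairProj, mem_inter_iff, Prod.fst_swap, Prod.snd_swap]
    tauto
  · have : (Prod.swap ⁻¹' ((proj N t ⁻¹' B) ×ˢ (proj N t ⁻¹' A)) : Set (Path N × Path N))
        = pairProj N t ⁻¹' (A ×ˢ B) := by
      ext p
      simp only [mem_preimage, mem_prod, pairProj, Prod.fst_swap, Prod.snd_swap]
      tauto
    rw [this]
    rfl

lemma gamma_step (N : ℕ) (μ ν : Measure (Path N)) [IsProbabilityMeasure μ]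
    [IsProbabilityMeasure ν] (γ : Measure (Path N × Path N)) [IsProbabilityMeasure γ]
    (hγ : IsBicausal N μ ν γ) (hm : IsIncreasingTriangularPlan N γ) (t : ℕ) (ht : t < N) :
    γ.map (stepMap N t) = (γ.map (pairProj N t)) ⊗ₘ pushK (comonFun N μ ν t) := by
  obtain ⟨S, hSm, hS⟩ : ∃ S : Kernel ((Fin t → ℝ) × (Fin t → ℝ)) (ℝ × ℝ), IsMarkovKernel S ∧
      (γ.map (pairProj N t)) ⊗ₘ S = γ.map (stepMap N t) := by
    refine ⟨(γ.map (stepMap N t)).condKernel, inferInstance, ?_⟩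
    have h := (γ.map (stepMap N t)).disintegrate (γ.map (stepMap N t)).condKernel
    have h2 : (γ.map (stepMap N t)).fst = γ.map (pairProj N t) :=
      Measure.fst_map_prodMk (measurable_coords N t)
    rwa [h2] at h
  have hmono : ∀ᵐ z ∂(γ.map (pairProj N t)), MonotoneSet (msupport (S z)) := by
    rcases Nat.eq_zero_or_pos t with h0 | hpos
    · subst h0
      refine ae_of_all _ fun z => ?_
      rw [step_zero N γ S hS z]
      exact hm.1
    · exact hm.2 t hpos ht S inferInstance hS
  have h1 : (γ.map (pairProj N t)) ⊗ₘ (S.map Prod.fst)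
      = (γ.map (pairProj N t)) ⊗ₘ ((nextK N μ t).comap Prod.fst measurable_fst) := by
    rw [← causal_fst N μ ν γ hγ.1 t ht.le, Measure.compProd_map measurable_fst, hS,
      Measure.map_map (by fun_prop) (measurable_stepMap N t)]
    rfl
  have h2 : (γ.map (pairProj N t)) ⊗ₘ (S.map Prod.snd)
      = (γ.map (pairProj N t)) ⊗ₘ ((nextK N ν t).comap Prod.snd measurable_snd) := by
    rw [← causal_snd N μ ν γ hγ.2 t ht.le, Measure.compProd_map measurable_snd, hS,
      Measure.map_map (by fun_prop) (measurable_stepMap N t)]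
    rfl
  have := Kernel.IsMarkovKernel.map S measurable_fst
  have := Kernel.IsMarkovKernel.map S measurable_snd
  have h1' := ae_eq_of_compProd_sfinite _ _ _ h1
  have h2' := ae_eq_of_compProd_sfinite _ _ _ h2
  rw [← hS]
  refine Measure.compProd_congr ?_
  filter_upwards [hmono, h1', h2'] with z hz hz1 hz2
  rw [Kernel.map_apply _ measurable_fst, Kernel.comap_apply] at hz1
  rw [Kernel.map_apply _ measurable_snd, Kernel.comap_apply] at hz2
  rw [comon_apply]
  exact comon_unique (nextK N μ t z.1) (nextK N ν t z.2) (S z) hz hz1 hz2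

lemma pairProj_eq (N : ℕ) (μ ν : Measure (Path N)) [IsProbabilityMeasure μ]
    [IsProbabilityMeasure ν] (γ : Measure (Path N × Path N)) [IsProbabilityMeasure γ]
    (hγ : IsBicausal N μ ν γ) (hm : IsIncreasingTriangularPlan N γ) (t : ℕ) (ht : t ≤ N) :
    γ.map (pairProj N t) = (krCoupling N μ ν).map (pairProj N t) := by
  induction t with
  | zero =>
    have h1 := Measure.isProbabilityMeasure_map (μ := γ) (measurable_pairProj N 0).aemeasurable
    have h2 := Measure.isProbabilityMeasure_map (μ := krCoupling N μ ν)
      (measurable_pairProj N 0).aemeasurable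
    ext s hs
    rcases s.eq_empty_or_nonempty with h | ⟨b, hb⟩
    · simp [h]
    · have : s = univ := by
        ext y
        rw [Subsingleton.elim y b]
        simp [hb]
      rw [this, measure_univ, measure_univ]
  | succ t ih =>
    have h := (gamma_step N μ ν γ hγ hm t (by omega)).trans
      ((congrArg (· ⊗ₘ pushK (comonFun N μ ν t)) (ih (by omega))).trans
        (kr_step N μ ν t (by omega)).symm)
    let c : ((Fin t → ℝ) × (Fin t → ℝ)) × (ℝ × ℝ) → (Fin (t + 1) → ℝ) × (Fin (t + 1) → ℝ) :=
      fun q => (snocFun t q.1.1 q.2.1, snocFun t q.1.2 q.2.2)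
    have hcm : Measurable c :=
      ((measurable_snocFun t).comp ((measurable_fst.comp measurable_fst).prodMk
        (measurable_fst.comp measurable_snd))).prodMk
      ((measurable_snocFun t).comp ((measurable_snd.comp measurable_fst).prodMk
        (measurable_snd.comp measurable_snd)))
    have e : pairProj N (t + 1) = c ∘ stepMap N t := by
      funext p
      simp only [pairProj, proj_succ, Function.comp, c, stepMap]
    rw [e, ← Measure.map_map hcm (measurable_stepMap N t), h,
      Measure.map_map hcm (measurable_stepMap N t)]

theorem knothe_rosenblatt_unique_increasing_triangular_plan
    (N : ℕ) (μ ν : Measure (Path N)) [IsProbabilityMeasure μ] [IsProbabilityMeasure ν] :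
    (IsBicausal N μ ν (krCoupling N μ ν)
      ∧ IsIncreasingTriangularPlan N (krCoupling N μ ν))
    ∧ (∀ γ : Measure (Path N × Path N), IsBicausal N μ ν γ →
        IsIncreasingTriangularPlan N γ → γ = krCoupling N μ ν) := by
  refine ⟨⟨kr_bicausal N μ ν, kr_triangular N μ ν⟩, fun γ hγ hm => ?_⟩
  have : IsProbabilityMeasure γ := by
    constructor
    have h := measure_univ (μ := μ)
    rwa [← hγ.1.1.1, Measure.map_apply measurable_fst .univ] at h
  have h := pairProj_eq N μ ν γ hγ hm N le_rfl
  have e : pairProj N N = id := by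
    funext p
    simp only [pairProj, proj_self, id]
  rwa [e, Measure.map_id, Measure.map_id] at h

end CausalTransport
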